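/- Let X and Y be real Banach spaces. The norm of the injective tensor product X ⊗̂_ε Y is non-rough if and only if the norm of X is non-rough and the norm of Y is non-rough. -/

import Mathlib

set_option synthInstance.maxHeartbeats 1000000
set_option maxHeartbeats 1000000
set_option maxSynthPendingDepth 3

open Metric Set Filter

noncomputable section

/-- A Banach space `Z` has the **Ball Dentable Property** (`BDP`) if its closed unit ball
has slices of arbitrarily small diameter. -/
def BallDentableProperty (Z : Type*) [NormedAddCommGroup Z] [NormedSpace ℝ Z] : Prop :=
  ∀ ε : ℝ, 0 < ε → ∃ (f : StrongDual ℝ Z) (α : ℝ), ‖f‖ = 1 ∧ 0 < α ∧ α < 1 ∧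
    Metric.diam {z : Z | ‖z‖ ≤ 1 ∧ 1 - α < f z} < ε

/-- The dual `Z*` of a Banach space `Z` has the **w*-Ball Dentable Property** (`w*-BDP`) if the
closed unit ball of `Z*` has weak-star slices (slices given by elements of the predual `Z`)
of arbitrarily small diameter. -/
def WStarBallDentableProperty (Z : Type*) [NormedAddCommGroup Z] [NormedSpace ℝ Z] : Prop :=
  ∀ ε : ℝ, 0 < ε → ∃ (z : Z) (α : ℝ), ‖z‖ = 1 ∧ 0 < α ∧ α < 1 ∧
    Metric.diam {f : StrongDual ℝ Z | ‖f‖ ≤ 1 ∧ 1 - α < f z} < ε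

/-- A Banach space `Z` has the **Ball Small Combination of Slices Property** (`BSCSP`) if its
closed unit ball has convex combinations of slices of arbitrarily small diameter. -/
def BallSCSProperty (Z : Type*) [NormedAddCommGroup Z] [NormedSpace ℝ Z] : Prop :=
  ∀ ε : ℝ, 0 < ε → ∃ (n : ℕ) (lam : Fin (n + 1) → ℝ) (f : Fin (n + 1) → StrongDual ℝ Z)
    (α : Fin (n + 1) → ℝ),
    (∀ i, 0 < lam i) ∧ (∑ i, lam i = 1) ∧ (∀ i, ‖f i‖ = 1) ∧ (∀ i, 0 < α i ∧ α i < 1) ∧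
    Metric.diam {z : Z | ∃ g : Fin (n + 1) → Z,
      (∀ i, ‖g i‖ ≤ 1 ∧ 1 - α i < f i (g i)) ∧ z = ∑ i, lam i • g i} < ε

/-- The dual `Z*` of a Banach space `Z` has the **w*-Ball Small Combination of Slices Property**
(`w*-BSCSP`) if the closed unit ball of `Z*` has convex combinations of weak-star slices
(slices given by elements of the predual `Z`) of arbitrarily small diameter. -/
def WStarBallSCSProperty (Z : Type*) [NormedAddCommGroup Z] [NormedSpace ℝ Z] : Prop :=
  ∀ ε : ℝ, 0 < ε → ∃ (n : ℕ) (lam : Fin (n + 1) → ℝ) (z : Fin (n + 1) → Z)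
    (α : Fin (n + 1) → ℝ),
    (∀ i, 0 < lam i) ∧ (∑ i, lam i = 1) ∧ (∀ i, ‖z i‖ = 1) ∧ (∀ i, 0 < α i ∧ α i < 1) ∧
    Metric.diam {φ : StrongDual ℝ Z | ∃ g : Fin (n + 1) → StrongDual ℝ Z,
      (∀ i, ‖g i‖ ≤ 1 ∧ 1 - α i < g i (z i)) ∧ φ = ∑ i, lam i • g i} < ε

/-- The roughness `η(Z, u)` of the norm of `Z` at `u`:
`limsup_{‖h‖ → 0} (‖u + h‖ + ‖u - h‖ - 2) / ‖h‖`. -/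
noncomputable def roughness (Z : Type*) [NormedAddCommGroup Z] (u : Z) : ℝ :=
  Filter.limsup (fun h : Z => (‖u + h‖ + ‖u - h‖ - 2) / ‖h‖) (nhdsWithin 0 {(0 : Z)}ᶜ)

/-- The norm of `Z` is **rough** if it is `ε`-rough for some `ε > 0`, i.e. there is `ε > 0`
with `η(Z, u) ≥ ε` for every `u` in the unit sphere of `Z`. -/
def RoughNorm (Z : Type*) [NormedAddCommGroup Z] : Prop :=
  ∃ ε : ℝ, 0 < ε ∧ ∀ u : Z, ‖u‖ = 1 → ε ≤ roughness Z u

/-- The norm of `Z` is **non-rough** if it is not rough. -/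
def NonRoughNorm (Z : Type*) [NormedAddCommGroup Z] : Prop := ¬ RoughNorm Z

/-- The rank-one operator `x* ⊗ y : E → F`, `x ↦ x*(x) • y`. -/
noncomputable def rankOneOp {E F : Type*} [NormedAddCommGroup E] [NormedSpace ℝ E]
    [NormedAddCommGroup F] [NormedSpace ℝ F] (f : StrongDual ℝ E) (y : F) : E →L[ℝ] F :=
  f.smulRight y

/-- For a subspace `H ⊆ L(E, F)`, a vector `x ∈ E` and a functional `g ∈ F*`, the functional
`x ⊗ g ∈ H*` given by `T ↦ g (T x)`. -/
noncomputable def dualTensorFunctional {E F : Type*} [NormedAddCommGroup E] [NormedSpace ℝ E]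
    [NormedAddCommGroup F] [NormedSpace ℝ F] (H : Submodule ℝ (E →L[ℝ] F)) (x : E)
    (g : StrongDual ℝ F) : StrongDual ℝ H :=
  g.comp ((ContinuousLinearMap.apply ℝ F x).comp H.subtypeL)

/-- The weak-star closed convex hull of a subset `S` of the dual `Z*`. -/
noncomputable def wStarClosedConvexHull (Z : Type*) [NormedAddCommGroup Z] [NormedSpace ℝ Z]
    (S : Set (StrongDual ℝ Z)) : Set (StrongDual ℝ Z) :=
  StrongDual.toWeakDual ⁻¹'
    closure (convexHull ℝ (StrongDual.toWeakDual '' S))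

/-- `D(Z, u)`: the set of norm-at-most-one functionals attaining the value `1` at `u`. -/
def dualFace (Z : Type*) [NormedAddCommGroup Z] [NormedSpace ℝ Z] (u : Z) :
    Set (StrongDual ℝ Z) := {h | ‖h‖ ≤ 1 ∧ h u = 1}

/-- `n(Z, u)`: the largest non-negative `k` such that
`k * ‖z‖ ≤ sup {|f z| : f ∈ D(Z, u)}` for every `z ∈ Z`. -/
noncomputable def nConstant (Z : Type*) [NormedAddCommGroup Z] [NormedSpace ℝ Z] (u : Z) : ℝ :=
  sSup {k : ℝ | 0 ≤ k ∧ ∀ z : Z, k * ‖z‖ ≤ ⨆ f : dualFace Z u, |f.1 z|}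

/-- The Banach space `B(X × Y)` of bounded bilinear forms on `X × Y`, realized as
`X →L[ℝ] Y →L[ℝ] ℝ`. -/
def BoundedBilinearForms (X Y : Type*) [NormedAddCommGroup X] [NormedSpace ℝ X]
    [NormedAddCommGroup Y] [NormedSpace ℝ Y] : Type _ :=
  X →L[ℝ] Y →L[ℝ] ℝ

noncomputable instance {X Y : Type*} [NormedAddCommGroup X] [NormedSpace ℝ X]
    [NormedAddCommGroup Y] [NormedSpace ℝ Y] : NormedAddCommGroup (BoundedBilinearForms X Y) :=
  inferInstanceAs (NormedAddCommGroup (X →L[ℝ] Y →L[ℝ] ℝ))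

noncomputable instance {X Y : Type*} [NormedAddCommGroup X] [NormedSpace ℝ X]
    [NormedAddCommGroup Y] [NormedSpace ℝ Y] : NormedSpace ℝ (BoundedBilinearForms X Y) :=
  inferInstanceAs (NormedSpace ℝ (X →L[ℝ] Y →L[ℝ] ℝ))

/-- The canonical image of the elementary tensor `x ⊗ y` in the dual of the space of bounded
bilinear forms on `X × Y`; it acts by `B ↦ B x y`. -/
noncomputable def projTensorElem {X Y : Type*} [NormedAddCommGroup X] [NormedSpace ℝ X]
    [NormedAddCommGroup Y] [NormedSpace ℝ Y] (x : X) (y : Y) :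
    StrongDual ℝ (BoundedBilinearForms X Y) :=
  (ContinuousLinearMap.apply ℝ ℝ y).comp (ContinuousLinearMap.apply ℝ (Y →L[ℝ] ℝ) x)

/-- The projective tensor product `X ⊗̂_π Y`, realized canonically (and isometrically) as the
closure of the span of the elementary tensors inside the dual of the Banach space of bounded
bilinear forms on `X × Y`.  (On elementary tensor combinations the dual norm coincides with the
projective norm, so this closed subspace is the canonical isometric copy of the completion
`X ⊗̂_π Y`.) -/
noncomputable def ProjectiveTensorProduct (X Y : Type*) [NormedAddCommGroup X] [NormedSpace ℝ X]
    [NormedAddCommGroup Y] [NormedSpace ℝ Y] :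
    Submodule ℝ (StrongDual ℝ (BoundedBilinearForms X Y)) :=
  (Submodule.span ℝ {φ | ∃ x y, φ = projTensorElem x y}).topologicalClosure

/-- The projective tensor product `X ⊗̂_π Y` as a Banach space. -/
def ProjectiveTensorSpace (X Y : Type*) [NormedAddCommGroup X] [NormedSpace ℝ X]
    [NormedAddCommGroup Y] [NormedSpace ℝ Y] : Type _ :=
  ↥(ProjectiveTensorProduct X Y)

noncomputable instance {X Y : Type*} [NormedAddCommGroup X] [NormedSpace ℝ X]
    [NormedAddCommGroup Y] [NormedSpace ℝ Y] : NormedAddCommGroup (ProjectiveTensorSpace X Y) :=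
  inferInstanceAs (NormedAddCommGroup ↥(ProjectiveTensorProduct X Y))

noncomputable instance {X Y : Type*} [NormedAddCommGroup X] [NormedSpace ℝ X]
    [NormedAddCommGroup Y] [NormedSpace ℝ Y] : NormedSpace ℝ (ProjectiveTensorSpace X Y) :=
  inferInstanceAs (NormedSpace ℝ ↥(ProjectiveTensorProduct X Y))

/-- The rank-one operator `x ⊗ y : X* → Y`, `x* ↦ x*(x) • y`. -/
noncomputable def injTensorElem {X Y : Type*} [NormedAddCommGroup X] [NormedSpace ℝ X]
    [NormedAddCommGroup Y] [NormedSpace ℝ Y] (x : X) (y : Y) :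
    StrongDual ℝ X →L[ℝ] Y :=
  (ContinuousLinearMap.apply ℝ ℝ x).smulRight y

/-- The injective tensor product `X ⊗̂_ε Y`, realized canonically (and isometrically) as the
closure of the span of the rank-one operators `x ⊗ y` inside the Banach space `L(X*, Y)`.
(On elementary tensor combinations the operator norm coincides with the injective norm, so this
closed subspace is the canonical isometric copy of the completion `X ⊗̂_ε Y`.) -/
noncomputable def InjectiveTensorProduct (X Y : Type*) [NormedAddCommGroup X] [NormedSpace ℝ X]
    [NormedAddCommGroup Y] [NormedSpace ℝ Y] :
    Submodule ℝ (StrongDual ℝ X →L[ℝ] Y) :=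
  (Submodule.span ℝ {T | ∃ x y, T = injTensorElem x y}).topologicalClosure

/-- The injective tensor product `X ⊗̂_ε Y` as a Banach space. -/
def InjectiveTensorSpace (X Y : Type*) [NormedAddCommGroup X] [NormedSpace ℝ X]
    [NormedAddCommGroup Y] [NormedSpace ℝ Y] : Type _ :=
  ↥(InjectiveTensorProduct X Y)

noncomputable instance {X Y : Type*} [NormedAddCommGroup X] [NormedSpace ℝ X]
    [NormedAddCommGroup Y] [NormedSpace ℝ Y] : NormedAddCommGroup (InjectiveTensorSpace X Y) :=
  inferInstanceAs (NormedAddCommGroup ↥(InjectiveTensorProduct X Y))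

noncomputable instance {X Y : Type*} [NormedAddCommGroup X] [NormedSpace ℝ X]
    [NormedAddCommGroup Y] [NormedSpace ℝ Y] : NormedSpace ℝ (InjectiveTensorSpace X Y) :=
  inferInstanceAs (NormedSpace ℝ ↥(InjectiveTensorProduct X Y))

end

/-- Quantitative form of non-roughness. -/
theorem nonRough_iff_aux (Z : Type*) [NormedAddCommGroup Z] [NormedSpace ℝ Z] :
    NonRoughNorm Z ↔ ∀ ε : ℝ, 0 < ε → ∃ u : Z, ‖u‖ = 1 ∧ ∃ δ : ℝ, 0 < δ ∧
      ∀ h : Z, ‖h‖ ≤ δ → ‖u + h‖ + ‖u - h‖ ≤ 2 + ε * ‖h‖ := by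
  unfold NonRoughNorm RoughNorm
  constructor
  · intro H ε hε
    by_contra hcon
    apply H
    refine ⟨ε, hε, fun u hu => ?_⟩
    by_contra hlt
    push Not at hlt
    apply hcon
    refine ⟨u, hu, ?_⟩
    have hb : IsBoundedUnder (· ≤ ·) (nhdsWithin 0 {(0 : Z)}ᶜ)
        (fun h : Z => (‖u + h‖ + ‖u - h‖ - 2) / ‖h‖) := by
      refine ⟨2, ?_⟩
      rw [eventually_map]
      refine Eventually.of_forall fun h => ?_
      apply div_le_of_le_mul₀ (norm_nonneg _) (by norm_num)
      have h1 := norm_add_le u h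
      have h2 := norm_sub_le u h
      linarith
    have hev := eventually_lt_of_limsup_lt (show limsup _ _ < ε from hlt) hb
    rw [eventually_nhdsWithin_iff, Metric.eventually_nhds_iff] at hev
    obtain ⟨δ, hδ, hh⟩ := hev
    refine ⟨δ / 2, by positivity, fun h hle => ?_⟩
    by_cases h0 : h = 0
    · subst h0; simp [hu]; norm_num
    · have := hh (y := h) (by rw [dist_zero_right]; linarith) h0
      rw [div_lt_iff₀ (norm_pos_iff.2 h0)] at this
      linarith
  · rintro H ⟨ε, hε, hr⟩
    obtain ⟨u, hu, δ, hδ, hh⟩ := H (ε / 2) (by positivity)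
    have h1 := hr u hu
    haveI : Nontrivial Z := ⟨u, 0, by intro h; simp [h] at hu⟩
    haveI : (nhdsWithin (0 : Z) {(0 : Z)}ᶜ).NeBot := Module.punctured_nhds_neBot ℝ Z 0
    have hb : IsBoundedUnder (· ≥ ·) (nhdsWithin 0 {(0 : Z)}ᶜ)
        (fun h : Z => (‖u + h‖ + ‖u - h‖ - 2) / ‖h‖) := by
      refine ⟨0, ?_⟩
      rw [eventually_map]
      refine Eventually.of_forall fun h => ?_
      apply div_nonneg _ (norm_nonneg _)
      have h1 := norm_add_le (u + h) (u - h)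
      have h2 : (u + h) + (u - h) = (2 : ℝ) • u := by module
      rw [h2, norm_smul, hu] at h1
      norm_num at h1
      linarith
    have h2 : roughness Z u ≤ ε / 2 := by
      unfold roughness
      refine limsup_le_of_le hb.isCoboundedUnder_le ?_
      rw [eventually_nhdsWithin_iff, Metric.eventually_nhds_iff]
      refine ⟨δ, hδ, fun h hd h0 => ?_⟩
      rw [dist_zero_right] at hd
      rw [div_le_iff₀ (norm_pos_iff.2 h0)]
      linarith [hh h hd.le]
    linarith

/-- A bound on a sphere bounds the norm of a functional. -/
theorem norm_le_of_sphere_aux {Z : Type*} [NormedAddCommGroup Z] [NormedSpace ℝ Z]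
    (f : StrongDual ℝ Z) (δ c : ℝ) (hδ : 0 < δ) (hc : 0 ≤ c)
    (H : ∀ h : Z, ‖h‖ = δ → f h ≤ c * δ) : ‖f‖ ≤ c := by
  refine f.opNorm_le_bound hc fun z => ?_
  by_cases hz : z = 0
  · simp [hz]
  have hz' : 0 < ‖z‖ := norm_pos_iff.2 hz
  have key : ∀ w : Z, ‖w‖ = ‖z‖ → f w ≤ c * ‖z‖ := by
    intro w hw
    have := H ((δ / ‖z‖) • w) (by
      rw [norm_smul, hw, Real.norm_of_nonneg (by positivity)]; field_simp)
    rw [map_smul, smul_eq_mul, div_mul_eq_mul_div, div_le_iff₀ hz'] at this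
    have h3 : δ * f w ≤ δ * (c * ‖z‖) := by linarith
    exact le_of_mul_le_mul_left h3 hδ
  rw [Real.norm_eq_abs, abs_le]
  constructor
  · have := key (-z) (norm_neg z)
    rw [map_neg] at this
    linarith
  · exact key z rfl

theorem apply_le_aux {Z : Type*} [NormedAddCommGroup Z] [NormedSpace ℝ Z]
    (f : StrongDual ℝ Z) (hf : ‖f‖ ≤ 1) (z : Z) : f z ≤ ‖z‖ := by
  have h1 := f.le_of_opNorm_le hf z
  have h2 := le_abs_self (f z)
  rw [Real.norm_eq_abs] at h1
  linarith

/-- Non-rough implies small slices. -/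
theorem slice_of_nonRough_aux {Z : Type*} [NormedAddCommGroup Z] [NormedSpace ℝ Z]
    (H : NonRoughNorm Z) (ε : ℝ) (hε : 0 < ε) :
    ∃ u : Z, ‖u‖ = 1 ∧ ∃ α : ℝ, 0 < α ∧ ∀ f f' : StrongDual ℝ Z, ‖f‖ ≤ 1 → ‖f'‖ ≤ 1 →
      1 - α < f u → 1 - α < f' u → ‖f - f'‖ ≤ ε := by
  obtain ⟨u, hu, δ, hδ, hh⟩ := (nonRough_iff_aux Z).1 H (ε / 2) (by positivity)
  refine ⟨u, hu, ε * δ / 4, by positivity, fun f f' hf hf' h1 h2 => ?_⟩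
  refine norm_le_of_sphere_aux _ δ ε hδ hε.le fun h hn => ?_
  have a1 := apply_le_aux f hf (u + h)
  have a2 := apply_le_aux f' hf' (u - h)
  have a3 := hh h hn.le
  rw [map_add] at a1
  rw [map_sub] at a2
  rw [hn] at a3
  simp only [sub_apply]
  linarith

/-- Small slices imply non-rough. -/
theorem nonRough_of_slice_aux {Z : Type*} [NormedAddCommGroup Z] [NormedSpace ℝ Z]
    (H : ∀ ε : ℝ, 0 < ε → ∃ (x : Z) (α : ℝ), α < 1 ∧ 1 - α < ‖x‖ ∧
      ∀ f f' : StrongDual ℝ Z, ‖f‖ ≤ 1 → ‖f'‖ ≤ 1 →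
      1 - α < f x → 1 - α < f' x → ‖f - f'‖ ≤ ε) : NonRoughNorm Z := by
  rw [nonRough_iff_aux]
  intro ε hε
  obtain ⟨x, α, hα, hx, hs⟩ := H ε hε
  have hx0 : 0 < ‖x‖ := by linarith
  have hu : ‖‖x‖⁻¹ • x‖ = 1 := by
    rw [norm_smul, norm_inv, norm_norm]; field_simp
  set u := ‖x‖⁻¹ • x with hudef
  have hxu : x = ‖x‖ • u := by rw [hudef, smul_smul]; field_simp; simp
  set β := (‖x‖ - (1 - α)) / ‖x‖ with hβ
  have hβ0 : 0 < β := div_pos (by linarith) hx0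
  have hβx : ‖x‖ * (1 - β) = 1 - α := by rw [hβ]; field_simp; ring
  refine ⟨u, hu, β / 4, by positivity, fun h hn => ?_⟩
  obtain ⟨f, hf, hfe⟩ := exists_dual_vector'' ℝ (u + h)
  obtain ⟨f', hf', hfe'⟩ := exists_dual_vector'' ℝ (u - h)
  simp only [RCLike.ofReal_real_eq_id, id] at hfe hfe'
  have b1 : 1 ≤ ‖u + h‖ + ‖h‖ := by
    have := norm_sub_le (u + h) h; rw [add_sub_cancel_right, hu] at this; exact this
  have b2 : 1 ≤ ‖u - h‖ + ‖h‖ := by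
    have := norm_add_le (u - h) h; rw [sub_add_cancel, hu] at this; exact this
  have c1 := apply_le_aux f hf h
  have c2 := apply_le_aux f' hf' (-h)
  have c3 := apply_le_aux f hf u
  have c4 := apply_le_aux f' hf' u
  rw [map_neg, norm_neg] at c2
  rw [map_add] at hfe
  rw [map_sub] at hfe'
  rw [hu] at c3 c4
  have d := hs f f' hf hf'
    (by rw [hxu, map_smul, smul_eq_mul, ← hβx]
        exact mul_lt_mul_of_pos_left (by linarith) hx0)
    (by rw [hxu, map_smul, smul_eq_mul, ← hβx]
        exact mul_lt_mul_of_pos_left (by linarith) hx0)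
  have e := (f - f').le_of_opNorm_le d h
  have e2 := le_abs_self ((f - f') h)
  rw [Real.norm_eq_abs] at e
  simp only [sub_apply] at e e2
  linarith

/-- Nearly norming pairs for an operator on a dual space. -/
theorem exists_pair_aux {E F : Type*} [NormedAddCommGroup E] [NormedSpace ℝ E]
    [NormedAddCommGroup F] [NormedSpace ℝ F] (S : E →L[ℝ] F) (c : ℝ) (hc : c < ‖S‖) (hc0 : 0 ≤ c) :
    ∃ (e : E) (g : StrongDual ℝ F), ‖e‖ ≤ 1 ∧ ‖g‖ ≤ 1 ∧ c < g (S e) := by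
  obtain ⟨e, he, hce⟩ := S.exists_lt_apply_of_lt_opNorm hc
  obtain ⟨g, hg, hge⟩ := exists_dual_vector'' ℝ (S e)
  refine ⟨e, g, he.le, hg, ?_⟩
  rw [hge]; exact hce

theorem injTensorElem_apply_aux {X Y : Type*} [NormedAddCommGroup X] [NormedSpace ℝ X]
    [NormedAddCommGroup Y] [NormedSpace ℝ Y] (x : X) (y : Y) (f : StrongDual ℝ X) :
    injTensorElem x y f = f x • y := rfl

theorem injTensorElem_mem_aux {X Y : Type*} [NormedAddCommGroup X] [NormedSpace ℝ X]
    [NormedAddCommGroup Y] [NormedSpace ℝ Y] (x : X) (y : Y) :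
    injTensorElem x y ∈ InjectiveTensorProduct X Y :=
  Submodule.le_topologicalClosure _ (Submodule.subset_span ⟨x, y, rfl⟩)

theorem injTensorElem_norm_le_aux {X Y : Type*} [NormedAddCommGroup X] [NormedSpace ℝ X]
    [NormedAddCommGroup Y] [NormedSpace ℝ Y] (x : X) (y : Y) :
    ‖injTensorElem x y‖ ≤ ‖x‖ * ‖y‖ := by
  refine ContinuousLinearMap.opNorm_le_bound _ (by positivity) fun f => ?_
  rw [injTensorElem_apply_aux, norm_smul]
  have := f.le_opNorm x
  calc ‖f x‖ * ‖y‖ ≤ (‖f‖ * ‖x‖) * ‖y‖ := by gcongr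
    _ = _ := by ring

theorem injTensorElem_norm_aux {X Y : Type*} [NormedAddCommGroup X] [NormedSpace ℝ X]
    [NormedAddCommGroup Y] [NormedSpace ℝ Y] (x : X) (y : Y) (hx : ‖x‖ = 1) (hy : ‖y‖ = 1) :
    ‖injTensorElem x y‖ = 1 := by
  apply le_antisymm
  · have := injTensorElem_norm_le_aux x y; rwa [hx, hy, one_mul] at this
  · obtain ⟨f, hf, hfx⟩ := exists_dual_vector'' ℝ x
    have := (injTensorElem x y).le_opNorm f
    rw [injTensorElem_apply_aux, hfx, norm_smul, hx, hy] at this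
    simp at this
    nlinarith [norm_nonneg (injTensorElem x y)]

/-- The tensor norm: elements of the tensor product compose with functionals to elements
of `X`. -/
theorem exists_predual_aux {X Y : Type*} [NormedAddCommGroup X] [NormedSpace ℝ X]
    [CompleteSpace X] [NormedAddCommGroup Y] [NormedSpace ℝ Y]
    (T : StrongDual ℝ X →L[ℝ] Y) (hT : T ∈ InjectiveTensorProduct X Y) (g : StrongDual ℝ Y) :
    ∃ x : X, ∀ f : StrongDual ℝ X, g (T f) = f x := by
  let C : Set (StrongDual ℝ X →L[ℝ] Y) := {S | g.comp S ∈
    Set.range (NormedSpace.inclusionInDoubleDualLi ℝ (E := X))}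
  have hC : IsClosed C := by
    have h1 : IsClosed (Set.range (NormedSpace.inclusionInDoubleDualLi ℝ (E := X))) :=
      (NormedSpace.inclusionInDoubleDualLi ℝ (E := X)).isometry.isClosedEmbedding.isClosed_range
    exact h1.preimage ((ContinuousLinearMap.compL ℝ (StrongDual ℝ X) Y ℝ g).continuous)
  have hsub : ((Submodule.span ℝ {T | ∃ x y, T = injTensorElem x y} :
      Submodule ℝ (StrongDual ℝ X →L[ℝ] Y)) : Set (StrongDual ℝ X →L[ℝ] Y)) ⊆ C := by
    intro S hS
    refine Submodule.span_induction (p := fun S _ => S ∈ C) ?_ ?_ ?_ ?_ hS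
    · rintro _ ⟨x, y, rfl⟩
      refine ⟨g y • x, ?_⟩
      ext f
      change f (g y • x) = g (f x • y)
      simp [mul_comm]
    · exact ⟨0, by ext f; simp⟩
    · rintro S1 S2 _ _ ⟨x1, h1⟩ ⟨x2, h2⟩
      exact ⟨x1 + x2, by rw [map_add, h1, h2]; ext f; simp⟩
    · rintro a S1 _ ⟨x1, h1⟩
      exact ⟨a • x1, by rw [map_smul, h1]; ext f; simp⟩
  have hT' : T ∈ closure ((Submodule.span ℝ {T | ∃ x y, T = injTensorElem x y} :
      Submodule ℝ (StrongDual ℝ X →L[ℝ] Y)) : Set (StrongDual ℝ X →L[ℝ] Y)) := hT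
  obtain ⟨x, hx⟩ := hC.closure_subset_iff.2 hsub hT'
  refine ⟨x, fun f => ?_⟩
  have := congrArg (fun F => F f) hx
  exact this.symm

/-- Sufficient condition in terms of operators. -/
theorem nonRough_inj_iff_aux (X Y : Type*) [NormedAddCommGroup X] [NormedSpace ℝ X]
    [NormedAddCommGroup Y] [NormedSpace ℝ Y] :
    NonRoughNorm (InjectiveTensorSpace X Y) ↔ ∀ ε : ℝ, 0 < ε →
      ∃ u ∈ InjectiveTensorProduct X Y, ‖u‖ = 1 ∧ ∃ δ : ℝ, 0 < δ ∧
      ∀ h ∈ InjectiveTensorProduct X Y, ‖h‖ ≤ δ → ‖u + h‖ + ‖u - h‖ ≤ 2 + ε * ‖h‖ := by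
  rw [nonRough_iff_aux]
  constructor
  · intro H ε hε
    obtain ⟨u, hu, δ, hδ, hh⟩ := H ε hε
    exact ⟨u.1, u.2, hu, δ, hδ, fun h hm hn => hh ⟨h, hm⟩ hn⟩
  · intro H ε hε
    obtain ⟨u, hm, hu, δ, hδ, hh⟩ := H ε hε
    exact ⟨⟨u, hm⟩, hu, δ, hδ, fun h hn => hh h.1 h.2 hn⟩

/-- Sign normalization of almost norming pairs. -/
theorem sign_pair_aux {X Y : Type*} [NormedAddCommGroup X] [NormedSpace ℝ X]
    [NormedAddCommGroup Y] [NormedSpace ℝ Y] (x : X) (y : Y) (hx : ‖x‖ = 1) (hy : ‖y‖ = 1)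
    (S : StrongDual ℝ X →L[ℝ] Y) (t : ℝ) (ht : 0 ≤ t) (ht1 : 2 * t < 1)
    (hS : ‖S‖ ≤ t) (τ : ℝ) (hτ : 0 < τ) (hτ1 : 2 * t + τ < 1) :
    ∃ (f : StrongDual ℝ X) (g : StrongDual ℝ Y), ‖f‖ ≤ 1 ∧ ‖g‖ ≤ 1 ∧
      1 - (2 * t + τ) < f x ∧ 1 - (2 * t + τ) < g y ∧
      ‖injTensorElem x y + S‖ - τ < f x * g y + g (S f) := by
  have hn : 1 - t ≤ ‖injTensorElem x y + S‖ := by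
    have h1 := norm_sub_le (injTensorElem x y + S) S
    rw [add_sub_cancel_right, injTensorElem_norm_aux x y hx hy] at h1
    linarith
  obtain ⟨f, g, hf, hg, hc⟩ := exists_pair_aux (injTensorElem x y + S)
    (‖injTensorElem x y + S‖ - τ) (by linarith) (by linarith)
  rw [add_apply, map_add, injTensorElem_apply_aux, map_smul,
    smul_eq_mul] at hc
  have hb : g (S f) ≤ t := by
    refine (apply_le_aux g hg _).trans ?_
    refine (S.le_opNorm f).trans ?_
    calc ‖S‖ * ‖f‖ ≤ t * 1 := by gcongr
      _ = t := mul_one t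
  have a1 := apply_le_aux f hf x
  have a2 := apply_le_aux g hg y
  have a3 := apply_le_aux f hf (-x)
  have a4 := apply_le_aux g hg (-y)
  rw [hx] at a1
  rw [hy] at a2
  rw [map_neg, norm_neg, hx] at a3
  rw [map_neg, norm_neg, hy] at a4
  have hp : 1 - (2 * t + τ) < f x * g y := by linarith
  by_cases hpos : 0 < f x
  · have hg0 : 0 < g y := by
      by_contra hcon
      push Not at hcon
      nlinarith
    refine ⟨f, g, hf, hg, ?_, ?_, hc⟩ <;> nlinarith
  · push Not at hpos
    have hg0 : g y < 0 := by
      by_contra hcon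
      push Not at hcon
      nlinarith
    refine ⟨-f, -g, by rwa [norm_neg], by rwa [norm_neg], ?_, ?_, ?_⟩
    · rw [neg_apply]; nlinarith
    · rw [neg_apply]; nlinarith
    · simp only [neg_apply, map_neg]; linarith

theorem inj_of_both_aux {X Y : Type*} [NormedAddCommGroup X] [NormedSpace ℝ X]
    [NormedAddCommGroup Y] [NormedSpace ℝ Y] (HX : NonRoughNorm X) (HY : NonRoughNorm Y) :
    NonRoughNorm (InjectiveTensorSpace X Y) := by
  rw [nonRough_inj_iff_aux]
  intro ε hε
  obtain ⟨x, hx, α, hα, hsx⟩ := slice_of_nonRough_aux HX (ε / 2) (by positivity)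
  obtain ⟨y, hy, β, hβ, hsy⟩ := slice_of_nonRough_aux HY (ε / 2) (by positivity)
  obtain ⟨δ, hδ, hδα, hδβ, hδ1⟩ : ∃ δ : ℝ, 0 < δ ∧ 3 * δ ≤ α ∧ 3 * δ ≤ β ∧ 3 * δ < 1 := by
    refine ⟨min (min (α / 3) (β / 3)) (1 / 4), by positivity, ?_, ?_, ?_⟩
    · have := min_le_left (min (α / 3) (β / 3)) (1 / 4)
      have := min_le_left (α / 3) (β / 3)
      linarith
    · have := min_le_left (min (α / 3) (β / 3)) (1 / 4)
      have := min_le_right (α / 3) (β / 3)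
      linarith
    · have := min_le_right (min (α / 3) (β / 3)) (1 / 4)
      linarith
  refine ⟨_, injTensorElem_mem_aux x y, injTensorElem_norm_aux x y hx hy, δ, hδ, ?_⟩
  intro T _ hT
  have main : ∀ τ : ℝ, 0 < τ → τ ≤ δ →
      ‖injTensorElem x y + T‖ + ‖injTensorElem x y - T‖ ≤ 2 + ε * ‖T‖ + 2 * τ := by
    intro τ hτ hτδ
    obtain ⟨f, g, hf, hg, hfx, hgy, h1⟩ := sign_pair_aux x y hx hy T δ hδ.le (by linarith) hT τ
      hτ (by linarith)
    obtain ⟨f', g', hf', hg', hfx', hgy', h2⟩ := sign_pair_aux x y hx hy (-T) δ hδ.le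
      (by linarith) (by rwa [norm_neg]) τ hτ (by linarith)
    have k1 := hsx f f' hf hf' (by linarith) (by linarith)
    have k2 := hsy g g' hg hg' (by linarith) (by linarith)
    rw [← sub_eq_add_neg, neg_apply, map_neg] at h2
    have a1 := apply_le_aux f hf x
    have a2 := apply_le_aux g hg y
    have a3 := apply_le_aux f' hf' x
    have a4 := apply_le_aux g' hg' y
    rw [hx] at a1 a3
    rw [hy] at a2 a4
    have p1 : f x * g y ≤ 1 := by nlinarith
    have p2 : f' x * g' y ≤ 1 := by nlinarith
    have q1 : g (T (f - f')) ≤ ε / 2 * ‖T‖ := by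
      refine (apply_le_aux g hg _).trans ((T.le_opNorm _).trans ?_)
      rw [mul_comm]; gcongr
    have q2 : (g - g') (T f') ≤ ε / 2 * ‖T‖ := by
      have r1 : ‖T f'‖ ≤ ‖T‖ := by
        refine (T.le_opNorm f').trans ?_
        calc ‖T‖ * ‖f'‖ ≤ ‖T‖ * 1 := by gcongr
          _ = ‖T‖ := mul_one _
      refine (le_abs_self _).trans (((g - g').le_opNorm (T f')).trans ?_)
      gcongr
    rw [map_sub, map_sub] at q1
    rw [sub_apply] at q2
    linarith
  refine le_of_forall_pos_le_add fun η hη => ?_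
  have m := main (min δ (η / 2)) (by positivity) (min_le_left _ _)
  have := min_le_right δ (η / 2)
  linarith

theorem both_of_inj_aux {X Y : Type*} [NormedAddCommGroup X] [NormedSpace ℝ X]
    [CompleteSpace X] [NormedAddCommGroup Y] [NormedSpace ℝ Y]
    (H : NonRoughNorm (InjectiveTensorSpace X Y)) : NonRoughNorm X ∧ NonRoughNorm Y := by
  rw [nonRough_inj_iff_aux] at H
  -- common data
  have D : ∀ ε : ℝ, 0 < ε → ∃ u ∈ InjectiveTensorProduct X Y, ∃ (α δ : ℝ), 0 < δ ∧ α < 1 ∧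
      8 * α ≤ ε * δ ∧
      (∀ h ∈ InjectiveTensorProduct X Y, ‖h‖ ≤ δ → ‖u + h‖ + ‖u - h‖ ≤ 2 + ε / 4 * δ) ∧
      ∃ (f₀ : StrongDual ℝ X) (g₀ : StrongDual ℝ Y), ‖f₀‖ ≤ 1 ∧ ‖g₀‖ ≤ 1 ∧ 1 - α < g₀ (u f₀) ∧
        (1 / 2 < ‖f₀‖) ∧ (1 / 2 < ‖g₀‖) := by
    intro ε hε
    obtain ⟨u, hm, hu, δ, hδ, hh⟩ := H (ε / 4) (by positivity)
    have hα0 : 0 < min (1 / 2) (ε * δ / 8) := by positivity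
    have hα1 := min_le_left (1 / 2) (ε * δ / 8)
    have hα2 := min_le_right (1 / 2) (ε * δ / 8)
    set α := min (1 / 2) (ε * δ / 8)
    obtain ⟨f₀, g₀, hf, hg, hc⟩ := exists_pair_aux u (1 - α) (by linarith) (by linarith)
    have hb : g₀ (u f₀) ≤ ‖g₀‖ * ‖f₀‖ := by
      refine (le_abs_self _).trans ((g₀.le_opNorm _).trans ?_)
      gcongr
      have := u.le_opNorm f₀
      rwa [hu, one_mul] at this
    refine ⟨u, hm, α, δ, hδ, by linarith, by linarith, ?_, f₀, g₀, hf, hg, hc, ?_, ?_⟩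
    · intro h hm hn
      have := hh h hm hn
      have : ε / 4 * ‖h‖ ≤ ε / 4 * δ := by gcongr
      linarith
    · nlinarith [norm_nonneg f₀, norm_nonneg g₀]
    · nlinarith [norm_nonneg f₀, norm_nonneg g₀]
  have B : ∀ (S : StrongDual ℝ X →L[ℝ] Y) (f : StrongDual ℝ X) (g : StrongDual ℝ Y),
      ‖f‖ ≤ 1 → ‖g‖ ≤ 1 → g (S f) ≤ ‖S‖ := by
    intro S f g hf hg
    refine (apply_le_aux g hg _).trans ((S.le_opNorm f).trans ?_)
    calc ‖S‖ * ‖f‖ ≤ ‖S‖ * 1 := by gcongr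
      _ = ‖S‖ := mul_one _
  constructor
  · apply nonRough_of_slice_aux
    intro ε hε
    obtain ⟨u, hm, α, δ, hδ, hα1, hαε, hh, f₀, g₀, hf₀, hg₀, hc, -, hg2⟩ := D ε hε
    obtain ⟨x, hx⟩ := exists_predual_aux u hm g₀
    refine ⟨x, α, hα1, ?_, ?_⟩
    · rw [hx] at hc
      exact hc.trans_le (apply_le_aux f₀ hf₀ x)
    intro f f' hf hf' h1 h2
    obtain ⟨k, hk, hgk, -, -⟩ : ∃ k : Y, ‖k‖ ≤ 1 ∧ 1 / 2 < g₀ k ∧ True ∧ True := by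
      obtain ⟨k, hk, hgk⟩ := g₀.exists_lt_apply_of_lt_opNorm hg2
      rw [Real.norm_eq_abs, lt_abs] at hgk
      rcases hgk with h | h
      · exact ⟨k, hk.le, h, trivial, trivial⟩
      · exact ⟨-k, by rw [norm_neg]; exact hk.le, by rw [map_neg]; exact h, trivial, trivial⟩
    refine norm_le_of_sphere_aux _ δ ε hδ hε.le fun h hn => ?_
    have hle : ‖injTensorElem h k‖ ≤ δ := by
      refine (injTensorElem_norm_le_aux h k).trans ?_
      rw [hn]; nlinarith
    have a := hh _ (injTensorElem_mem_aux h k) hle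
    have b1 := B (u + injTensorElem h k) f g₀ hf hg₀
    have b2 := B (u - injTensorElem h k) f' g₀ hf' hg₀
    simp only [add_apply, sub_apply, map_add, map_sub,
      injTensorElem_apply_aux, map_smul, smul_eq_mul, hx] at b1 b2
    rw [sub_apply]
    have c : (f h - f' h) * g₀ k ≤ ε * δ * (1 / 2) + (2 * α - ε * δ / 2) + ε / 4 * δ := by linarith
    by_contra hcon
    push Not at hcon
    have : 0 < ε * δ := by positivity
    nlinarith
  · apply nonRough_of_slice_aux
    intro ε hε
    obtain ⟨u, hm, α, δ, hδ, hα1, hαε, hh, f₀, g₀, hf₀, hg₀, hc, hf2, -⟩ := D ε hε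
    refine ⟨u f₀, α, hα1, hc.trans_le (apply_le_aux g₀ hg₀ _), ?_⟩
    intro g g' hg hg' h1 h2
    obtain ⟨k, hk, hgk⟩ : ∃ k : X, ‖k‖ ≤ 1 ∧ 1 / 2 < f₀ k := by
      obtain ⟨k, hk, hgk⟩ := f₀.exists_lt_apply_of_lt_opNorm hf2
      rw [Real.norm_eq_abs, lt_abs] at hgk
      rcases hgk with h | h
      · exact ⟨k, hk.le, h⟩
      · exact ⟨-k, by rw [norm_neg]; exact hk.le, by rw [map_neg]; exact h⟩
    refine norm_le_of_sphere_aux _ δ ε hδ hε.le fun h hn => ?_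
    have hle : ‖injTensorElem k h‖ ≤ δ := by
      refine (injTensorElem_norm_le_aux k h).trans ?_
      rw [hn]; nlinarith
    have a := hh _ (injTensorElem_mem_aux k h) hle
    have b1 := B (u + injTensorElem k h) f₀ g hf₀ hg
    have b2 := B (u - injTensorElem k h) f₀ g' hf₀ hg'
    simp only [add_apply, sub_apply, map_add, map_sub,
      injTensorElem_apply_aux, map_smul, smul_eq_mul] at b1 b2
    rw [sub_apply]
    have c : (g h - g' h) * f₀ k ≤ 2 * α + ε / 4 * δ := by linarith
    by_contra hcon
    push Not at hcon
    have : 0 < ε * δ := by positivity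
    nlinarith

/-- Proposition 3.4: the norm of the injective tensor product `X ⊗̂_ε Y` is
non-rough if and only if the norms of both `X` and `Y` are non-rough. -/
theorem statement19 {X Y : Type*} [NormedAddCommGroup X] [NormedSpace ℝ X] [CompleteSpace X]
    [NormedAddCommGroup Y] [NormedSpace ℝ Y] [CompleteSpace Y] :
    NonRoughNorm (InjectiveTensorSpace X Y) ↔ NonRoughNorm X ∧ NonRoughNorm Y :=
  ⟨both_of_inj_aux, fun h => inj_of_both_aux h.1 h.2⟩
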